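/- arXiv:2007.04227 — 2 statements merged into one kernel-verified Lean document; each statement's English description precedes it below -/
import Mathlib

section
/- Let Ω = (0,∞)², l₁, l₂ ∈ ℕ with (l₁,l₂) ≠ (0,0), and κ_l(r) = l(l+1)/(2r²) - 1/r + 1/2. Then the bilinear form a(u,v) = (1/2)∫_Ω ∇u·∇v + ∫_Ω (κ_{l₁}(r₁) + κ_{l₂}(r₂)) u v on H¹₀(Ω) satisfies a(v,v) ≥ (3/8)‖v‖²_{L²(Ω)} for all v ∈ H¹₀(Ω). -/
open MeasureTheory

/-- The quadrant `Ω = (0,∞)²`. -/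
def Om : Set (ℝ × ℝ) := Set.Ioi 0 ×ˢ Set.Ioi 0

/-- The effective radial potential `κ_l(r) = l(l+1)/(2r²) - 1/r + 1/2`. -/
noncomputable def kappa (l : ℕ) (r : ℝ) : ℝ :=
  (l : ℝ) * ((l : ℝ) + 1) / (2 * r ^ 2) - 1 / r + 1 / 2

open Set Filter Topology

/-- `f` lies in `H¹₀(0,∞)` with pointwise derivative `f'` on the open half-line. -/
structure HalfLineH1Zero (f f' : ℝ → ℝ) : Prop where
  continuousOn : ContinuousOn f (Ici 0)
  zero : f 0 = 0
  hasDerivAt : ∀ x ∈ Ioi (0 : ℝ), HasDerivAt f (f' x) x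
  sq_integrable : IntegrableOn (fun x => f x ^ 2) (Ioi 0)
  deriv_sq_integrable : IntegrableOn (fun x => f' x ^ 2) (Ioi 0)

namespace HalfLineH1Zero

variable {f f' : ℝ → ℝ}

lemma aestronglyMeasurable (h : HalfLineH1Zero f f') :
    AEStronglyMeasurable f (volume.restrict (Ioi 0)) :=
  (h.continuousOn.mono Ioi_subset_Ici_self).aestronglyMeasurable measurableSet_Ioi

lemma deriv_aestronglyMeasurable (h : HalfLineH1Zero f f') :
    AEStronglyMeasurable f' (volume.restrict (Ioi 0)) :=
  (stronglyMeasurable_deriv f).aestronglyMeasurable.congr <|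
    (ae_restrict_mem measurableSet_Ioi).mono fun x hx => (h.hasDerivAt x hx).deriv

lemma deriv_integrableOn_Ioc (h : HalfLineH1Zero f f') (r : ℝ) :
    IntegrableOn f' (Ioc 0 r) := by
  have hsub : Ioc (0 : ℝ) r ⊆ Ioi 0 := Ioc_subset_Ioi_self
  have hone : IntegrableOn (fun _ : ℝ => (1 : ℝ)) (Ioc 0 r) := by simp
  refine (hone.add (h.deriv_sq_integrable.mono_set hsub)).mono'
    (h.deriv_aestronglyMeasurable.mono_set hsub) (ae_of_all _ fun x => ?_)
  rw [Real.norm_eq_abs, abs_le]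
  simp only [Pi.add_apply]
  constructor <;> nlinarith [sq_nonneg (f' x + 1), sq_nonneg (f' x - 1)]

lemma sq_div_le_integral (h : HalfLineH1Zero f f') {r : ℝ} (hr : 0 < r) :
    f r ^ 2 / r ≤ ∫ x in (0 : ℝ)..r, f' x ^ 2 := by
  have hint : IntervalIntegrable f' volume 0 r :=
    (intervalIntegrable_iff_integrableOn_Ioc_of_le hr.le).2 (h.deriv_integrableOn_Ioc r)
  have hint2 : IntervalIntegrable (fun x => f' x ^ 2) volume 0 r :=
    (intervalIntegrable_iff_integrableOn_Ioc_of_le hr.le).2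
      (h.deriv_sq_integrable.mono_set Ioc_subset_Ioi_self)
  have hftc : ∫ x in (0 : ℝ)..r, f' x = f r := by
    rw [intervalIntegral.integral_eq_sub_of_hasDerivAt_of_le hr.le
      (h.continuousOn.mono Icc_subset_Ici_self) (fun x hx => h.hasDerivAt x hx.1) hint,
      h.zero, sub_zero]
  have hpos : 0 ≤ ∫ x in (0 : ℝ)..r, (f' x - f r / r) ^ 2 :=
    intervalIntegral.integral_nonneg hr.le fun x _ => sq_nonneg _
  have hexp : ∫ x in (0 : ℝ)..r, (f' x - f r / r) ^ 2
      = (∫ x in (0 : ℝ)..r, f' x ^ 2) - f r ^ 2 / r := by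
    have : ∀ x, (f' x - f r / r) ^ 2 = f' x ^ 2 - (2 * (f r / r)) * f' x + (f r / r) ^ 2 :=
      fun x => by ring
    simp only [this]
    rw [intervalIntegral.integral_add (hint2.sub (hint.const_mul _))
      intervalIntegrable_const, intervalIntegral.integral_sub hint2 (hint.const_mul _),
      intervalIntegral.integral_const_mul, hftc, intervalIntegral.integral_const]
    simp only [smul_eq_mul]
    field_simp
    ring
  linarith

lemma tendsto_sq_div (h : HalfLineH1Zero f f') :
    Tendsto (fun x => f x ^ 2 / x) (𝓝[>] 0) (𝓝 0) := by
  have hcont : ContinuousOn (fun r => ∫ x in (0 : ℝ)..r, f' x ^ 2) (uIcc 0 1) :=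
    intervalIntegral.continuousOn_primitive_interval'
      ((intervalIntegrable_iff_integrableOn_Ioc_of_le zero_le_one).2
        (h.deriv_sq_integrable.mono_set Ioc_subset_Ioi_self)) left_mem_uIcc
  have hlim : Tendsto (fun r => ∫ x in (0 : ℝ)..r, f' x ^ 2) (𝓝[>] 0) (𝓝 0) := by
    have := (hcont 0 left_mem_uIcc).tendsto
    rw [uIcc_of_le zero_le_one, intervalIntegral.integral_same] at this
    exact this.mono_left (nhdsWithin_le_of_mem (Icc_mem_nhdsGT zero_lt_one))
  refine squeeze_zero' ?_ ?_ hlim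
  · filter_upwards [self_mem_nhdsWithin] with x hx
    exact div_nonneg (sq_nonneg _) (le_of_lt hx)
  · filter_upwards [self_mem_nhdsWithin] with x hx using h.sq_div_le_integral hx

lemma hasDerivAt_sq (h : HalfLineH1Zero f f') {x : ℝ} (hx : 0 < x) :
    HasDerivAt (fun x => f x ^ 2) (2 * f x * f' x) x := by
  simpa using (h.hasDerivAt x hx).fun_pow 2

lemma hasDerivAt_weight_mul_sq (h : HalfLineH1Zero f f') (a b : ℝ) {x : ℝ} (hx : 0 < x) :
    HasDerivAt (fun x => (a / x - b) * f x ^ 2)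
      (-(a / x ^ 2) * f x ^ 2 + (a / x - b) * (2 * f x * f' x)) x := by
  have hw : HasDerivAt (fun x : ℝ => a / x - b) (-(a / x ^ 2)) x := by
    have := ((hasDerivAt_inv hx.ne').const_mul a).sub_const b
    simpa [div_eq_mul_inv] using this
  exact hw.mul (h.hasDerivAt_sq hx)

lemma mul_deriv_integrableOn (h : HalfLineH1Zero f f') :
    IntegrableOn (fun x => 2 * f x * f' x) (Ioi 0) := by
  refine (h.sq_integrable.add h.deriv_sq_integrable).mono'
    ((h.aestronglyMeasurable.const_mul 2).mul h.deriv_aestronglyMeasurable)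
    (ae_of_all _ fun x => ?_)
  rw [Real.norm_eq_abs, abs_le]
  simp only [Pi.add_apply]
  constructor <;> nlinarith [sq_nonneg (f x + f' x), sq_nonneg (f x - f' x)]

lemma tendsto_sq_atTop (h : HalfLineH1Zero f f') :
    Tendsto (fun x => f x ^ 2) atTop (𝓝 0) :=
  tendsto_zero_of_hasDerivAt_of_integrableOn_Ioi (fun _ hx => h.hasDerivAt_sq hx)
    h.mul_deriv_integrableOn h.sq_integrable

lemma sq_div_sq_aestronglyMeasurable (h : HalfLineH1Zero f f') :
    AEStronglyMeasurable (fun x => f x ^ 2 / x ^ 2) (volume.restrict (Ioi 0)) := by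
  have h1 : AEMeasurable f (volume.restrict (Ioi 0)) := h.aestronglyMeasurable.aemeasurable
  exact (by fun_prop : AEMeasurable (fun x => f x ^ 2 / x ^ 2) _).aestronglyMeasurable

lemma integral_Ioc_sq_div_sq_le (h : HalfLineH1Zero f f') {r : ℝ} (hr : 0 < r) (hr1 : r ≤ 1) :
    IntegrableOn (fun x => f x ^ 2 / x ^ 2) (Ioc r 1) ∧
      ∫ x in Ioc r 1, f x ^ 2 / x ^ 2 ≤ 6 * ∫ x in Ioi 0, f' x ^ 2 := by
  have hsub : Ioc r 1 ⊆ Ioi 0 := fun x hx => hr.trans hx.1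
  have hcontf : ContinuousOn f (Icc r 1) :=
    h.continuousOn.mono fun x hx => hr.le.trans hx.1
  have hne : ∀ x ∈ Icc r 1, x ≠ 0 := fun x hx => (hr.trans_le hx.1).ne'
  have hq : IntegrableOn (fun x => f x ^ 2 / x ^ 2) (Ioc r 1) :=
    ((hcontf.pow 2).div (continuousOn_id.pow 2) fun x hx =>
      pow_ne_zero 2 (hne x hx)).integrableOn_Icc.mono_set Ioc_subset_Icc_self
  have hd := h.deriv_sq_integrable.mono_set hsub
  have hG : IntegrableOn
      (fun x => -(1 / x ^ 2) * f x ^ 2 + (1 / x - 0) * (2 * f x * f' x)) (Ioc r 1) := by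
    refine IntegrableOn.add ?_ ?_
    · simpa [div_eq_mul_inv, mul_comm] using hq.neg
    · have hm : IntegrableOn (fun x => 2 * f x * f' x) (Ioc r 1) :=
        h.mul_deriv_integrableOn.mono_set hsub
      have hw : ContinuousOn (fun x : ℝ => 1 / x - 0) (Icc r 1) :=
        (continuousOn_const.div continuousOn_id hne).sub continuousOn_const
      exact IntegrableOn.continuousOn_mul_of_subset hw hm isCompact_Icc measurableSet_Ioc
        Ioc_subset_Icc_self
  have hftc := intervalIntegral.integral_eq_sub_of_hasDerivAt_of_le hr1
    (f := fun x => (1 / x - 0) * f x ^ 2)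
    (((continuousOn_const.div continuousOn_id hne).sub continuousOn_const).mul (hcontf.pow 2))
    (fun x hx => h.hasDerivAt_weight_mul_sq 1 0 (hr.trans hx.1))
    ((intervalIntegrable_iff_integrableOn_Ioc_of_le hr1).2 hG)
  rw [intervalIntegral.integral_of_le hr1] at hftc
  have hD : ∫ x in Ioc r 1, f' x ^ 2 ≤ ∫ x in Ioi 0, f' x ^ 2 :=
    setIntegral_mono_set h.deriv_sq_integrable (ae_of_all _ fun x => sq_nonneg _)
      hsub.eventuallyLE
  have hbd : f r ^ 2 / r ≤ ∫ x in Ioi 0, f' x ^ 2 := by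
    refine (h.sq_div_le_integral hr).trans ?_
    rw [intervalIntegral.integral_of_le hr.le]
    exact setIntegral_mono_set h.deriv_sq_integrable (ae_of_all _ fun x => sq_nonneg _)
      Ioc_subset_Ioi_self.eventuallyLE
  have key : ∫ x in Ioc r 1, (1 / 4) * (f x ^ 2 / x ^ 2) ≤ ∫ x in Ioc r 1, (f' x ^ 2
      - (1 / 2) * (-(1 / x ^ 2) * f x ^ 2 + (1 / x - 0) * (2 * f x * f' x))) := by
    refine setIntegral_mono_on (hq.const_mul _) (hd.sub (hG.const_mul _)) measurableSet_Ioc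
      fun x hx => ?_
    have hx0 : x ≠ 0 := (hr.trans hx.1).ne'
    have : 0 ≤ (f' x - f x / (2 * x)) ^ 2 := sq_nonneg _
    have e : (f' x - f x / (2 * x)) ^ 2 = (f' x ^ 2
      - (1 / 2) * (-(1 / x ^ 2) * f x ^ 2 + (1 / x - 0) * (2 * f x * f' x)))
      - (1 / 4) * (f x ^ 2 / x ^ 2) := by field_simp; ring
    linarith
  rw [integral_sub hd (hG.const_mul _), integral_const_mul, integral_const_mul, hftc] at key
  have e : (1 / r - 0) * f r ^ 2 = f r ^ 2 / r := by ring
  refine ⟨hq, ?_⟩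
  simp only [e] at key
  nlinarith [sq_nonneg (f 1)]

lemma sq_div_sq_integrableOn (h : HalfLineH1Zero f f') :
    IntegrableOn (fun x => f x ^ 2 / x ^ 2) (Ioi 0) := by
  have h0 : IntegrableOn (fun x => f x ^ 2 / x ^ 2) (Ioc 0 1) := by
    have hr : ∀ n : ℕ, (0 : ℝ) < 1 / ((n : ℝ) + 1) := fun n => Nat.one_div_pos_of_nat
    have hr1 : ∀ n : ℕ, 1 / ((n : ℝ) + 1) ≤ 1 := fun n => by
      rw [div_le_one (by positivity)]; linarith [n.cast_nonneg (α := ℝ)]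
    refine integrableOn_Ioc_of_intervalIntegral_norm_bounded_left
      (I := 6 * ∫ x in Ioi 0, f' x ^ 2)
      (fun n => (h.integral_Ioc_sq_div_sq_le (hr n) (hr1 n)).1)
      tendsto_one_div_add_atTop_nhds_zero_nat (Eventually.of_forall fun n => ?_)
    have e : ∀ x, ‖f x ^ 2 / x ^ 2‖ = f x ^ 2 / x ^ 2 := fun x =>
      Real.norm_of_nonneg (by positivity)
    simp only [e]
    exact (h.integral_Ioc_sq_div_sq_le (hr n) (hr1 n)).2
  have h1 : IntegrableOn (fun x => f x ^ 2 / x ^ 2) (Ioi 1) := by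
    have hsub : Ioi (1 : ℝ) ⊆ Ioi 0 := Ioi_subset_Ioi zero_le_one
    refine (h.sq_integrable.mono_set hsub).mono'
      (h.sq_div_sq_aestronglyMeasurable.mono_set hsub) ?_
    filter_upwards [ae_restrict_mem measurableSet_Ioi] with x hx
    rw [Real.norm_of_nonneg (by positivity)]
    exact div_le_self (sq_nonneg _) (one_le_pow₀ (le_of_lt hx))
  rw [← Ioc_union_Ioi_eq_Ioi (zero_le_one (α := ℝ))]
  exact h0.union h1

lemma sq_div_integrableOn (h : HalfLineH1Zero f f') :
    IntegrableOn (fun x => f x ^ 2 / x) (Ioi 0) := by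
  have h1 : AEMeasurable f (volume.restrict (Ioi 0)) := h.aestronglyMeasurable.aemeasurable
  refine (h.sq_integrable.add h.sq_div_sq_integrableOn).mono'
    (by fun_prop : AEMeasurable (fun x => f x ^ 2 / x) _).aestronglyMeasurable
    (ae_of_all _ fun x => ?_)
  have e1 : f x ^ 2 / x ^ 2 = (f x / x) ^ 2 := by ring
  have e2 : f x ^ 2 / x = f x * (f x / x) := by ring
  rw [Real.norm_eq_abs, abs_le, Pi.add_apply, e1, e2]
  constructor <;> nlinarith [sq_nonneg (f x / x + f x), sq_nonneg (f x / x - f x)]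

/-- Completing the square with the weight `w = a / x - b`, for which
`w² + w' = (a² - a) / x² - 2ab / x + b²`. -/
lemma integral_deriv_sq_add_nonneg (h : HalfLineH1Zero f f') (a b : ℝ) :
    0 ≤ ∫ x in Ioi 0, (f' x ^ 2
      + ((a ^ 2 - a) / x ^ 2 - 2 * a * b / x + b ^ 2) * f x ^ 2) := by
  set G' : ℝ → ℝ := fun x => -(a / x ^ 2) * f x ^ 2 + (a / x - b) * (2 * f x * f' x) with hG'
  have hmeas : AEStronglyMeasurable (fun x => 1 / x * (2 * f x * f' x))
      (volume.restrict (Ioi 0)) := by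
    have h1 : AEMeasurable f (volume.restrict (Ioi 0)) := h.aestronglyMeasurable.aemeasurable
    have h2 : AEMeasurable f' (volume.restrict (Ioi 0)) :=
      h.deriv_aestronglyMeasurable.aemeasurable
    exact (by fun_prop : AEMeasurable (fun x => 1 / x * (2 * f x * f' x)) _).aestronglyMeasurable
  have hmix : IntegrableOn (fun x => 1 / x * (2 * f x * f' x)) (Ioi 0) := by
    refine (h.sq_div_sq_integrableOn.add h.deriv_sq_integrable).mono' hmeas
      (ae_of_all _ fun x => ?_)
    have e1 : f x ^ 2 / x ^ 2 = (f x / x) ^ 2 := by ring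
    have e2 : 1 / x * (2 * f x * f' x) = 2 * (f x / x) * f' x := by ring
    rw [Real.norm_eq_abs, abs_le, Pi.add_apply, e1, e2]
    constructor <;> nlinarith [sq_nonneg (f x / x + f' x), sq_nonneg (f x / x - f' x)]
  have hG'int : IntegrableOn G' (Ioi 0) := by
    refine (((h.sq_div_sq_integrableOn.const_mul (-a)).add (hmix.const_mul a)).sub
      (h.mul_deriv_integrableOn.const_mul b)).congr (ae_of_all _ fun x => ?_)
    simp only [hG', Pi.add_apply, Pi.sub_apply]
    ring
  have hcont : ContinuousWithinAt (fun x => (a / x - b) * f x ^ 2) (Ici 0) 0 := by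
    rw [← continuousWithinAt_Ioi_iff_Ici, ContinuousWithinAt]
    have hf0 : Tendsto (fun x => f x ^ 2) (𝓝[>] 0) (𝓝 0) := by
      have := ((h.continuousOn 0 self_mem_Ici).mono Ioi_subset_Ici_self).tendsto.pow 2
      simpa [h.zero] using this
    have := (h.tendsto_sq_div.const_mul a).sub (hf0.const_mul b)
    rw [mul_zero, mul_zero, sub_zero] at this
    rw [h.zero]
    refine (this.congr fun x => ?_).trans (by simp)
    ring
  have hinf : Tendsto (fun x => (a / x - b) * f x ^ 2) atTop (𝓝 0) := by
    simpa using ((tendsto_const_nhds.div_atTop tendsto_id).sub_const b).mul h.tendsto_sq_atTop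
  have hzero := integral_Ioi_of_hasDerivAt_of_tendsto hcont
    (fun x hx => h.hasDerivAt_weight_mul_sq a b hx) hG'int hinf
  simp only [h.zero, ne_eq, OfNat.ofNat_ne_zero, not_false_eq_true, zero_pow, mul_zero,
    sub_zero] at hzero
  have hlin : IntegrableOn (fun x => (f' x - (a / x - b) * f x) ^ 2) (Ioi 0) := by
    refine ((h.deriv_sq_integrable.sub ((hmix.const_mul a).sub
      (h.mul_deriv_integrableOn.const_mul b))).add (((h.sq_div_sq_integrableOn.const_mul (a ^ 2)).sub
      ((h.sq_div_integrableOn).const_mul (2 * a * b))).add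
      (h.sq_integrable.const_mul (b ^ 2)))).congr (ae_of_all _ fun x => ?_)
    simp only [Pi.add_apply, Pi.sub_apply]
    ring
  have hsplit : ∫ x in Ioi 0, (f' x ^ 2
      + ((a ^ 2 - a) / x ^ 2 - 2 * a * b / x + b ^ 2) * f x ^ 2)
      = ∫ x in Ioi 0, ((f' x - (a / x - b) * f x) ^ 2 + G' x) := by
    refine integral_congr_ae (ae_of_all _ fun x => ?_)
    simp only [hG']
    ring
  rw [hsplit, integral_add hlin hG'int, hzero, add_zero]
  exact integral_nonneg fun x => sq_nonneg _

end HalfLineH1Zero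

/-- Integrated over a parameter `y`, the radial lower bound
`(1/2) ∂ₓ² + l(l+1)/(2x²) - 1/x ≥ -1/(2(l+1)²)`. -/
lemma integral_radial_form_ge {u D : ℝ × ℝ → ℝ}
    (hu : Integrable (fun p => u p ^ 2)
      ((volume.restrict (Ioi 0)).prod (volume.restrict (Ioi 0))))
    (hD : Integrable (fun p => D p ^ 2)
      ((volume.restrict (Ioi 0)).prod (volume.restrict (Ioi 0))))
    (hmeas : AEMeasurable u ((volume.restrict (Ioi 0)).prod (volume.restrict (Ioi 0))))
    (hcont : ∀ y ∈ Ioi (0 : ℝ), ContinuousOn (fun x => u (x, y)) (Ici 0))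
    (hzero : ∀ y ∈ Ioi (0 : ℝ), u (0, y) = 0)
    (hderiv : ∀ y ∈ Ioi (0 : ℝ), ∀ x ∈ Ioi (0 : ℝ),
      HasDerivAt (fun x => u (x, y)) (D (x, y)) x) (l : ℕ) :
    Integrable (fun p => kappa l p.1 * u p ^ 2)
      ((volume.restrict (Ioi 0)).prod (volume.restrict (Ioi 0))) ∧
    (1 / 2 - 1 / (2 * ((l : ℝ) + 1) ^ 2)) *
        ∫ p, u p ^ 2 ∂((volume.restrict (Ioi 0)).prod (volume.restrict (Ioi 0)))
      ≤ (1 / 2) * (∫ p, D p ^ 2 ∂((volume.restrict (Ioi 0)).prod (volume.restrict (Ioi 0))))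
        + ∫ p, kappa l p.1 * u p ^ 2
            ∂((volume.restrict (Ioi 0)).prod (volume.restrict (Ioi 0))) := by
  set μ : Measure ℝ := volume.restrict (Ioi 0)
  have hslice : ∀ᵐ y ∂μ, HalfLineH1Zero (fun x => u (x, y)) (fun x => D (x, y)) := by
    filter_upwards [hu.prod_left_ae, hD.prod_left_ae, ae_restrict_mem measurableSet_Ioi]
      with y h1 h2 hy
    exact ⟨hcont y hy, hzero y hy, hderiv y hy, h1, h2⟩
  have hq : Integrable (fun p : ℝ × ℝ => u p ^ 2 / p.1 ^ 2) (μ.prod μ) := by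
    have hm : AEStronglyMeasurable (fun p : ℝ × ℝ => u p ^ 2 / p.1 ^ 2) (μ.prod μ) :=
      ((hmeas.pow_const 2).div (measurable_fst.pow_const 2).aemeasurable).aestronglyMeasurable
    rw [integrable_prod_iff' hm]
    refine ⟨hslice.mono fun y h => h.sq_div_sq_integrableOn,
      (hD.integral_prod_right.const_mul 4).mono' hm.prod_swap.norm.integral_prod_right' ?_⟩
    filter_upwards [hslice] with y h
    have e : ∀ x, ‖u (x, y) ^ 2 / x ^ 2‖ = u (x, y) ^ 2 / x ^ 2 := fun x =>
      Real.norm_of_nonneg (by positivity)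
    simp only [e]
    rw [Real.norm_of_nonneg (integral_nonneg fun x => by positivity)]
    have := h.integral_deriv_sq_add_nonneg (1 / 2) 0
    have e2 : ∀ x, D (x, y) ^ 2 + (((1 / 2 : ℝ) ^ 2 - 1 / 2) / x ^ 2 - 2 * (1 / 2) * 0 / x + 0 ^ 2)
        * u (x, y) ^ 2 = D (x, y) ^ 2 - (1 / 4) * (u (x, y) ^ 2 / x ^ 2) := fun x => by ring
    simp only [e2] at this
    rw [integral_sub h.deriv_sq_integrable (h.sq_div_sq_integrableOn.const_mul _),
      integral_const_mul] at this
    linarith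
  have hq1 : Integrable (fun p : ℝ × ℝ => u p ^ 2 / p.1) (μ.prod μ) := by
    refine (hu.add hq).mono'
      ((hmeas.pow_const 2).div measurable_fst.aemeasurable).aestronglyMeasurable
      (ae_of_all _ fun p => ?_)
    have e1 : u p ^ 2 / p.1 ^ 2 = (u p / p.1) ^ 2 := by ring
    have e2 : u p ^ 2 / p.1 = u p * (u p / p.1) := by ring
    rw [Real.norm_eq_abs, abs_le, Pi.add_apply, e1, e2]
    constructor <;> nlinarith [sq_nonneg (u p / p.1 + u p), sq_nonneg (u p / p.1 - u p)]
  have hk : Integrable (fun p => kappa l p.1 * u p ^ 2) (μ.prod μ) := by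
    refine (((hq.const_mul ((l : ℝ) * (l + 1) / 2)).sub hq1).add
      (hu.const_mul (1 / 2))).congr (ae_of_all _ fun p => ?_)
    simp only [Pi.add_apply, Pi.sub_apply, kappa]
    ring
  refine ⟨hk, ?_⟩
  have hl : (l : ℝ) + 1 ≠ 0 := by positivity
  have hform : ∀ p : ℝ × ℝ, (1 / 2) * D p ^ 2 + kappa l p.1 * u p ^ 2
        - (1 / 2 - 1 / (2 * ((l : ℝ) + 1) ^ 2)) * u p ^ 2
      = (1 / 2) * (D p ^ 2 + (((l + 1 : ℝ) ^ 2 - (l + 1)) / p.1 ^ 2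
        - 2 * (l + 1) * (1 / (l + 1)) / p.1 + (1 / (l + 1)) ^ 2) * u p ^ 2) := fun p => by
    have e : 2 * ((l : ℝ) + 1) * (1 / (l + 1)) = 2 := by field_simp
    have e₂ : 1 / (2 * ((l : ℝ) + 1) ^ 2) = 1 / 2 * (1 / (l + 1)) ^ 2 := by field_simp
    rw [e, e₂, kappa]
    ring
  have hsum : Integrable (fun p => (1 / 2) * D p ^ 2 + kappa l p.1 * u p ^ 2) (μ.prod μ) :=
    (hD.const_mul (1 / 2)).add hk
  have hint : Integrable (fun p => (1 / 2) * D p ^ 2 + kappa l p.1 * u p ^ 2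
      - (1 / 2 - 1 / (2 * ((l : ℝ) + 1) ^ 2)) * u p ^ 2) (μ.prod μ) :=
    hsum.sub (hu.const_mul _)
  have hnonneg : 0 ≤ ∫ p, ((1 / 2) * D p ^ 2 + kappa l p.1 * u p ^ 2
      - (1 / 2 - 1 / (2 * ((l : ℝ) + 1) ^ 2)) * u p ^ 2) ∂(μ.prod μ) := by
    rw [integral_prod_symm _ hint]
    refine integral_nonneg_of_ae (hslice.mono fun y h => ?_)
    simp only [Pi.zero_apply, hform]
    rw [integral_const_mul]
    exact mul_nonneg (by norm_num) (h.integral_deriv_sq_add_nonneg _ _)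
  rw [integral_sub hsum (hu.const_mul _),
    integral_add (hD.const_mul _) hk, integral_const_mul, integral_const_mul] at hnonneg
  linarith

lemma coercivity_const_le {l₁ l₂ : ℕ} (hl : (l₁, l₂) ≠ (0, 0)) :
    (3 / 8 : ℝ) ≤ (1 / 2 - 1 / (2 * ((l₁ : ℝ) + 1) ^ 2))
      + (1 / 2 - 1 / (2 * ((l₂ : ℝ) + 1) ^ 2)) := by
  have h0 : ∀ l : ℕ, 1 / (2 * ((l : ℝ) + 1) ^ 2) ≤ 1 / 2 := fun l => by
    have : (0 : ℝ) ≤ l := l.cast_nonneg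
    exact one_div_le_one_div_of_le (by norm_num) (by nlinarith)
  have h1 : ∀ l : ℕ, l ≠ 0 → 1 / (2 * ((l : ℝ) + 1) ^ 2) ≤ 1 / 8 := fun l hl => by
    have : (1 : ℝ) ≤ l := by exact_mod_cast Nat.one_le_iff_ne_zero.2 hl
    exact one_div_le_one_div_of_le (by norm_num) (by nlinarith)
  by_cases h : l₁ = 0
  · have := h1 l₂ fun h' => hl (by rw [h, h'])
    linarith [h0 l₁]
  · linarith [h1 l₁ h, h0 l₂]

/-- Coercivity of the modified Slater--Kirkwood bilinear form: for
`(l₁,l₂) ≠ (0,0)` and `v ∈ H¹₀(Ω)` (here: `v` continuous on the closure of `Ω`,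
vanishing outside `Ω`, differentiable in `Ω`, with `v` and `∇v` square integrable),
`a(v,v) = (1/2)∫_Ω |∇v|² + ∫_Ω (κ_{l₁}(r₁)+κ_{l₂}(r₂)) v² ≥ (3/8)‖v‖²_{L²(Ω)}`. -/
theorem slater_kirkwood_coercivity
    (l₁ l₂ : ℕ) (hl : (l₁, l₂) ≠ (0, 0))
    (v : ℝ × ℝ → ℝ)
    (hcont : ContinuousOn v (closure Om))
    (hzero : ∀ p ∉ Om, v p = 0)
    (hdiff : DifferentiableOn ℝ v Om)
    (hL2 : IntegrableOn (fun p => (v p) ^ 2) Om)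
    (hgrad : IntegrableOn
      (fun p => (fderiv ℝ v p (1, 0)) ^ 2 + (fderiv ℝ v p (0, 1)) ^ 2) Om)
    (hpot : IntegrableOn (fun p => (kappa l₁ p.1 + kappa l₂ p.2) * (v p) ^ 2) Om) :
    (3 / 8) * ∫ p in Om, (v p) ^ 2
      ≤ (1 / 2) * (∫ p in Om, ((fderiv ℝ v p (1, 0)) ^ 2 + (fderiv ℝ v p (0, 1)) ^ 2))
        + ∫ p in Om, (kappa l₁ p.1 + kappa l₂ p.2) * (v p) ^ 2 := by
  have hOm : (volume.restrict Om : Measure (ℝ × ℝ))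
      = (volume.restrict (Ioi 0)).prod (volume.restrict (Ioi 0)) :=
    (Measure.prod_restrict _ _).symm
  have hopen : IsOpen Om := isOpen_Ioi.prod isOpen_Ioi
  have hclosure : closure Om = Ici 0 ×ˢ Ici 0 := by
    rw [Om, closure_prod_eq, closure_Ioi]
  have hmeas : AEMeasurable v (volume.restrict Om) :=
    (hcont.mono subset_closure).aemeasurable hopen.measurableSet
  have hfd : ∀ p ∈ Om, HasFDerivAt v (fderiv ℝ v p) p := fun p hp =>
    (hdiff.differentiableAt (hopen.mem_nhds hp)).hasFDerivAt
  have hgrad₁ : IntegrableOn (fun p => (fderiv ℝ v p (1, 0)) ^ 2) Om :=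
    hgrad.mono' ((measurable_fderiv_apply_const ℝ v (1, 0)).pow_const 2).aestronglyMeasurable
      (ae_of_all _ fun p => by
        rw [Real.norm_of_nonneg (sq_nonneg _)]; exact le_add_of_nonneg_right (sq_nonneg _))
  have hgrad₂ : IntegrableOn (fun p => (fderiv ℝ v p (0, 1)) ^ 2) Om :=
    hgrad.mono' ((measurable_fderiv_apply_const ℝ v (0, 1)).pow_const 2).aestronglyMeasurable
      (ae_of_all _ fun p => by
        rw [Real.norm_of_nonneg (sq_nonneg _)]; exact le_add_of_nonneg_left (sq_nonneg _))
  rw [integral_add hgrad₁ hgrad₂]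
  simp only [IntegrableOn, hOm] at *
  obtain ⟨hk₁, hb₁⟩ := integral_radial_form_ge hL2 hgrad₁ hmeas
    (fun y hy => hcont.comp (by fun_prop) fun x hx => hclosure ▸ ⟨hx, Ioi_subset_Ici_self hy⟩)
    (fun y _ => hzero _ fun h => lt_irrefl (0 : ℝ) h.1)
    (fun y hy x hx => (hfd (x, y) ⟨hx, hy⟩).comp_hasDerivAt x
      ((hasDerivAt_id x).prodMk (hasDerivAt_const x y))) l₁
  obtain ⟨hk₂, hb₂⟩ := integral_radial_form_ge (u := v ∘ Prod.swap)
    (D := fun p => fderiv ℝ v p.swap (0, 1)) hL2.swap hgrad₂.swap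
    (hmeas.comp_quasiMeasurePreserving Measure.measurePreserving_swap.quasiMeasurePreserving)
    (fun y hy => hcont.comp (by fun_prop) fun x hx => hclosure ▸ ⟨Ioi_subset_Ici_self hy, hx⟩)
    (fun y _ => hzero _ fun h => lt_irrefl (0 : ℝ) h.2)
    (fun y hy x hx => (hfd (y, x) ⟨hy, hx⟩).comp_hasDerivAt x
      ((hasDerivAt_const x y).prodMk (hasDerivAt_id x))) l₂
  have hs := fun g : ℝ × ℝ → ℝ =>
    integral_prod_swap (μ := volume.restrict (Ioi (0 : ℝ)))
      (ν := volume.restrict (Ioi (0 : ℝ))) g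
  have e₁ := hs fun p => v p ^ 2
  have e₂ := hs fun p => fderiv ℝ v p (0, 1) ^ 2
  have e₃ := hs fun p => kappa l₂ p.2 * v p ^ 2
  simp only [Prod.snd_swap] at e₃
  simp only [Function.comp_apply, e₁, e₂, e₃] at hb₂
  have hk₂' := hk₂.swap
  simp only [Function.comp_def, Prod.swap_swap, Prod.fst_swap] at hk₂'
  simp only [add_mul]
  rw [integral_add hk₁ hk₂']
  have hc := mul_le_mul_of_nonneg_right (coercivity_const_le hl)
    (integral_nonneg (μ := (volume.restrict (Ioi (0 : ℝ))).prod (volume.restrict (Ioi (0 : ℝ))))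
      fun p => sq_nonneg (v p))
  linarith
end

section
/- Let Ω = (0,∞)², (l₁,l₂) ∈ ℕ² \ {(0,0)}, 0 ≤ α < √(3/8) and η > α. There is a constant C_α (independent of l₁, l₂, f, η) such that if f ∈ L²(Ω) satisfies ‖e^{η(r₁+r₂)} f‖_{L²(Ω)} < ∞, then the unique weak solution T ∈ H¹₀(Ω) of -(1/2)ΔT + (κ_{l₁}(r₁)+κ_{l₂}(r₂))T = f satisfies ‖e^{α(r₁+r₂)} T‖_{H¹(Ω)} ≤ C_α ‖e^{η(r₁+r₂)} f‖_{L²(Ω)}. -/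
open MeasureTheory

/-- Membership in `H¹₀(Ω)`. -/
def MemH10 (v : ℝ × ℝ → ℝ) : Prop :=
  ContinuousOn v (closure Om) ∧ (∀ p ∉ Om, v p = 0) ∧
    DifferentiableOn ℝ v Om ∧
    IntegrableOn (fun p => (v p) ^ 2) Om ∧
    IntegrableOn (fun p => (fderiv ℝ v p (1, 0)) ^ 2 + (fderiv ℝ v p (0, 1)) ^ 2) Om

/-- The bilinear form
`a(u,v) = (1/2)∫_Ω ∇u·∇v + ∫_Ω (κ_{l₁}(r₁)+κ_{l₂}(r₂)) u v`. -/
noncomputable def aform (l₁ l₂ : ℕ) (u v : ℝ × ℝ → ℝ) : ℝ :=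
  (1 / 2) * (∫ p in Om, (fderiv ℝ u p (1, 0) * fderiv ℝ v p (1, 0)
      + fderiv ℝ u p (0, 1) * fderiv ℝ v p (0, 1)))
    + ∫ p in Om, (kappa l₁ p.1 + kappa l₂ p.2) * u p * v p

/-- The (squared) `H¹(Ω)` norm of the exponentially weighted function
`e^{β(r₁+r₂)} v`. -/
noncomputable def expH1norm (β : ℝ) (v : ℝ × ℝ → ℝ) : ℝ :=
  Real.sqrt (∫ p in Om,
    ((Real.exp (β * (p.1 + p.2)) * v p) ^ 2
      + (fderiv ℝ (fun q => Real.exp (β * (q.1 + q.2)) * v q) p (1, 0)) ^ 2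
      + (fderiv ℝ (fun q => Real.exp (β * (q.1 + q.2)) * v q) p (0, 1)) ^ 2))

theorem integrable_and_integral_le_of_tendsto {X : Type*} [MeasurableSpace X] {μ : Measure X}
    {g : ℕ → X → ℝ} {G : X → ℝ} {K : ℝ} (hg : ∀ n, Integrable (g n) μ)
    (h0 : ∀ n, 0 ≤ᵐ[μ] g n) (hK : ∀ n, ∫ x, g n x ∂μ ≤ K)
    (hlim : ∀ᵐ x ∂μ, Filter.Tendsto (fun n => g n x) Filter.atTop (nhds (G x))) :
    Integrable G μ ∧ ∫ x, G x ∂μ ≤ K := by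
  have hG : AEStronglyMeasurable G μ :=
    aestronglyMeasurable_of_tendsto_ae Filter.atTop (fun n => (hg n).1) hlim
  have hG0 : 0 ≤ᵐ[μ] G := by
    filter_upwards [hlim, ae_all_iff.2 h0] with x hx h0x
    exact ge_of_tendsto' hx h0x
  have key : ∫⁻ x, ENNReal.ofReal (G x) ∂μ ≤ ENNReal.ofReal K := by
    calc ∫⁻ x, ENNReal.ofReal (G x) ∂μ
        = ∫⁻ x, Filter.liminf (fun n => ENNReal.ofReal (g n x)) Filter.atTop ∂μ := by
          refine lintegral_congr_ae ?_
          filter_upwards [hlim] with x hx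
          exact ((ENNReal.continuous_ofReal.tendsto _).comp hx).liminf_eq.symm
      _ ≤ Filter.liminf (fun n => ∫⁻ x, ENNReal.ofReal (g n x) ∂μ) Filter.atTop :=
          lintegral_liminf_le' fun n => (hg n).1.aemeasurable.ennreal_ofReal
      _ ≤ ENNReal.ofReal K := by
          refine Filter.liminf_le_of_le (by isBoundedDefault) fun b hb => ?_
          obtain ⟨n, hn⟩ := hb.exists
          refine hn.trans ?_
          rw [← ofReal_integral_eq_lintegral_ofReal (hg n) (h0 n)]
          exact ENNReal.ofReal_le_ofReal (hK n)
  have hK0 : 0 ≤ K := (integral_nonneg_of_ae (h0 0)).trans (hK 0)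
  refine ⟨⟨hG, ?_⟩, ?_⟩
  · rw [hasFiniteIntegral_iff_ofReal hG0]
    exact key.trans_lt ENNReal.ofReal_lt_top
  · rw [integral_eq_lintegral_of_nonneg_ae hG0 hG]
    exact ENNReal.toReal_le_of_le_ofReal hK0 key

theorem integrable_mul_mul_of_sq {X : Type*} [MeasurableSpace X] {μ : Measure X}
    {a u w : X → ℝ} {M : ℝ} (ha : AEStronglyMeasurable a μ) (haM : ∀ᵐ x ∂μ, |a x| ≤ M)
    (hu : AEStronglyMeasurable u μ) (hw : AEStronglyMeasurable w μ)
    (hu2 : Integrable (fun x => u x ^ 2) μ) (hw2 : Integrable (fun x => w x ^ 2) μ) :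
    Integrable (fun x => a x * u x * w x) μ := by
  refine ((hu2.add hw2).const_mul M).mono' ((ha.mul hu).mul hw) ?_
  filter_upwards [haM] with x hx
  have h1 : |u x * w x| ≤ u x ^ 2 + w x ^ 2 := by
    rw [abs_le]; constructor <;> nlinarith [sq_nonneg (u x + w x), sq_nonneg (u x - w x)]
  rw [Real.norm_eq_abs, mul_assoc, abs_mul]
  exact mul_le_mul hx h1 (abs_nonneg _) ((abs_nonneg _).trans hx)

theorem integral_Ioi_weighted_deriv_sq_eq_zero {u du φ dφ : ℝ → ℝ} {M : ℝ}
    (hu : ∀ x > 0, HasDerivAt u (du x) x) (huc : ContinuousWithinAt u (Set.Ici 0) 0)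
    (hu0 : u 0 = 0) (hum : Measurable u) (hdum : Measurable du)
    (hφ : ∀ x > 0, HasDerivAt φ (dφ x) x) (hφc : ContinuousWithinAt φ (Set.Ici 0) 0)
    (hφm : Measurable φ) (hdφm : Measurable dφ)
    (hφM : ∀ x > 0, |φ x| ≤ M) (hdφM : ∀ x > 0, |dφ x| ≤ M)
    (hu2 : IntegrableOn (fun x => u x ^ 2) (Set.Ioi 0))
    (hdu2 : IntegrableOn (fun x => du x ^ 2) (Set.Ioi 0)) :
    ∫ x in Set.Ioi 0, (dφ x * u x * u x + 2 * (φ x * u x * du x)) = 0 := by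
  have hφM' : ∀ᵐ x ∂volume.restrict (Set.Ioi (0 : ℝ)), |φ x| ≤ M :=
    (ae_restrict_mem measurableSet_Ioi).mono fun x hx => hφM x hx
  have hdφM' : ∀ᵐ x ∂volume.restrict (Set.Ioi (0 : ℝ)), |dφ x| ≤ M :=
    (ae_restrict_mem measurableSet_Ioi).mono fun x hx => hdφM x hx
  have hint : IntegrableOn (fun x => dφ x * u x * u x + 2 * (φ x * u x * du x)) (Set.Ioi 0) :=
    (integrable_mul_mul_of_sq hdφm.aestronglyMeasurable hdφM' hum.aestronglyMeasurable
      hum.aestronglyMeasurable hu2 hu2).add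
    ((integrable_mul_mul_of_sq hφm.aestronglyMeasurable hφM' hum.aestronglyMeasurable
      hdum.aestronglyMeasurable hu2 hdu2).const_mul 2)
  have hderiv : ∀ x ∈ Set.Ioi (0 : ℝ), HasDerivAt (fun x => φ x * u x * u x)
      (dφ x * u x * u x + 2 * (φ x * u x * du x)) x := fun x hx =>
    (((hφ x hx).mul (hu x hx)).mul (hu x hx)).congr_deriv (by simp only [Pi.mul_apply]; ring)
  have hint' : IntegrableOn (fun x => φ x * u x * u x) (Set.Ioi 0) :=
    integrable_mul_mul_of_sq hφm.aestronglyMeasurable hφM' hum.aestronglyMeasurable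
      hum.aestronglyMeasurable hu2 hu2
  have := integral_Ioi_of_hasDerivAt_of_tendsto (f := fun x => φ x * u x * u x)
    ((hφc.mul huc).mul huc) hderiv hint
    (tendsto_zero_of_hasDerivAt_of_integrableOn_Ioi hderiv hint hint')
  simpa [hu0] using this

theorem volume_restrict_Om : (volume.restrict Om : Measure (ℝ × ℝ)) =
    (volume.restrict (Set.Ioi 0)).prod (volume.restrict (Set.Ioi 0)) := by
  rw [Measure.prod_restrict, ← Measure.volume_eq_prod, Om]

theorem isOpen_Om : IsOpen Om := isOpen_Ioi.prod isOpen_Ioi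

theorem closure_Om : closure Om = Set.Ici 0 ×ˢ Set.Ici 0 := by
  rw [Om, closure_prod_eq, closure_Ioi]

theorem ae_Om : ∀ᵐ p ∂volume.restrict Om, 0 < p.1 ∧ 0 < p.2 :=
  (ae_restrict_mem isOpen_Om.measurableSet).mono fun _ hp => ⟨hp.1, hp.2⟩

theorem tendsto_add_inv (x : ℝ) :
    Filter.Tendsto (fun n : ℕ => x + 1 / ((n : ℝ) + 1)) Filter.atTop (nhds x) := by
  simpa using tendsto_one_div_add_atTop_nhds_zero_nat.const_add x

/-- A measurable function on the quadrant, square integrable together with its partial derivative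
`du` in the first variable, and vanishing on the side `{0} × (0,∞)`. -/
structure IsH1Left (u du : ℝ × ℝ → ℝ) : Prop where
  hasDerivAt : ∀ x > 0, ∀ y > 0, HasDerivAt (fun t => u (t, y)) (du (x, y)) x
  continuousWithinAt : ∀ y > 0, ContinuousWithinAt (fun t => u (t, y)) (Set.Ici 0) 0
  zero : ∀ y > 0, u (0, y) = 0
  measurable : Measurable u
  measurable_deriv : Measurable du
  integrable_sq : IntegrableOn (fun p => u p ^ 2) Om
  integrable_deriv_sq : IntegrableOn (fun p => du p ^ 2) Om

namespace IsH1Left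

variable {u du : ℝ × ℝ → ℝ}

theorem integral_weighted_eq_zero (h : IsH1Left u du) {φ dφ : ℝ → ℝ} {M : ℝ}
    (hφ : ∀ x > 0, HasDerivAt φ (dφ x) x) (hφc : ContinuousWithinAt φ (Set.Ici 0) 0)
    (hφm : Measurable φ) (hdφm : Measurable dφ)
    (hφM : ∀ x > 0, |φ x| ≤ M) (hdφM : ∀ x > 0, |dφ x| ≤ M) :
    ∫ p in Om, (dφ p.1 * u p * u p + 2 * (φ p.1 * u p * du p)) = 0 := by
  have hint : IntegrableOn
      (fun p : ℝ × ℝ => dφ p.1 * u p * u p + 2 * (φ p.1 * u p * du p)) Om :=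
    (integrable_mul_mul_of_sq (hdφm.comp measurable_fst).aestronglyMeasurable
      (ae_Om.mono fun p hp => hdφM p.1 hp.1) h.measurable.aestronglyMeasurable
      h.measurable.aestronglyMeasurable h.integrable_sq h.integrable_sq).add
    ((integrable_mul_mul_of_sq (hφm.comp measurable_fst).aestronglyMeasurable
      (ae_Om.mono fun p hp => hφM p.1 hp.1) h.measurable.aestronglyMeasurable
      h.measurable_deriv.aestronglyMeasurable h.integrable_sq h.integrable_deriv_sq).const_mul 2)
  have h1 := h.integrable_sq
  have h2 := h.integrable_deriv_sq
  unfold IntegrableOn at hint h1 h2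
  rw [volume_restrict_Om] at hint h1 h2 ⊢
  rw [integral_prod_symm _ hint]
  refine integral_eq_zero_of_ae ?_
  filter_upwards [h1.prod_left_ae, h2.prod_left_ae, ae_restrict_mem measurableSet_Ioi]
    with y h1y h2y hy
  exact integral_Ioi_weighted_deriv_sq_eq_zero (fun x hx => h.hasDerivAt x hx y hy)
    (h.continuousWithinAt y hy) (h.zero y hy) (h.measurable.comp measurable_prodMk_right)
    (h.measurable_deriv.comp measurable_prodMk_right) hφ hφc hφm hdφm hφM hdφM h1y h2y

theorem integrable_inv_add (h : IsH1Left u du) {ε : ℝ} (hε : 0 < ε) :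
    IntegrableOn (fun p => 1 / (p.1 + ε) * u p * u p) Om ∧
    IntegrableOn (fun p => 1 / (p.1 + ε) ^ 2 * u p * u p) Om := by
  constructor
  · refine integrable_mul_mul_of_sq (M := 1 / ε) (Measurable.aestronglyMeasurable (by fun_prop))
      (ae_Om.mono fun p hp => ?_)
      h.measurable.aestronglyMeasurable h.measurable.aestronglyMeasurable
      h.integrable_sq h.integrable_sq
    have := hp.1
    rw [abs_of_pos (by positivity)]
    gcongr; linarith
  · refine integrable_mul_mul_of_sq (M := 1 / ε ^ 2) (Measurable.aestronglyMeasurable (by fun_prop))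
      (ae_Om.mono fun p hp => ?_)
      h.measurable.aestronglyMeasurable h.measurable.aestronglyMeasurable
      h.integrable_sq h.integrable_sq
    have := hp.1
    rw [abs_of_pos (by positivity)]
    gcongr; linarith

theorem regularized_nonneg (h : IsH1Left u du) (m k : ℝ) {ε : ℝ} (hε : 0 < ε) :
    0 ≤ ∫ p in Om, (du p ^ 2 + (m ^ 2 - m) * (1 / (p.1 + ε) ^ 2 * u p * u p)
      - 2 * m * k * (1 / (p.1 + ε) * u p * u p) + k ^ 2 * u p ^ 2) := by
  have hb1 : ∀ x > 0, |m / (x + ε) - k| ≤ |m| / ε + |k| + |m| / ε ^ 2 := fun x hx => by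
    have : |m / (x + ε)| ≤ |m| / ε := by
      rw [abs_div, abs_of_pos (add_pos hx hε)]; gcongr; linarith
    have h3 : 0 ≤ |m| / ε ^ 2 := by positivity
    linarith [abs_sub (m / (x + ε)) k]
  have hb2 : ∀ x > 0, |-m / (x + ε) ^ 2| ≤ |m| / ε + |k| + |m| / ε ^ 2 := fun x hx => by
    have : |-m / (x + ε) ^ 2| ≤ |m| / ε ^ 2 := by
      rw [abs_div, abs_neg, abs_of_pos (pow_pos (add_pos hx hε) 2)]; gcongr; linarith
    have h3 : 0 ≤ |m| / ε := by positivity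
    linarith [abs_nonneg k]
  have hd : ∀ x ≥ 0, HasDerivAt (fun x => m / (x + ε) - k) (-m / (x + ε) ^ 2) x := fun x hx => by
    have hne : x + ε ≠ 0 := by positivity
    exact ((((hasDerivAt_const x m).div ((hasDerivAt_id x).add_const ε) hne)).sub_const k).congr_deriv
      (by simp)
  have hz := h.integral_weighted_eq_zero (fun x hx => hd x hx.le)
    (hd 0 le_rfl).continuousAt.continuousWithinAt (by fun_prop) (by fun_prop) hb1 hb2
  have hi1 : IntegrableOn (fun p => -m / (p.1 + ε) ^ 2 * u p * u p
      + 2 * ((m / (p.1 + ε) - k) * u p * du p)) Om :=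
    (integrable_mul_mul_of_sq (Measurable.aestronglyMeasurable (by fun_prop))
      (ae_Om.mono fun p hp => hb2 p.1 hp.1) h.measurable.aestronglyMeasurable
      h.measurable.aestronglyMeasurable h.integrable_sq h.integrable_sq).add
    ((integrable_mul_mul_of_sq (Measurable.aestronglyMeasurable (by fun_prop))
      (ae_Om.mono fun p hp => hb1 p.1 hp.1) h.measurable.aestronglyMeasurable
      h.measurable_deriv.aestronglyMeasurable h.integrable_sq h.integrable_deriv_sq).const_mul 2)
  have hi2 : IntegrableOn (fun p => du p ^ 2 + (m ^ 2 - m) * (1 / (p.1 + ε) ^ 2 * u p * u p)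
      - 2 * m * k * (1 / (p.1 + ε) * u p * u p) + k ^ 2 * u p ^ 2) Om :=
    ((h.integrable_deriv_sq.add ((h.integrable_inv_add hε).2.const_mul _)).sub
      ((h.integrable_inv_add hε).1.const_mul _)).add (h.integrable_sq.const_mul _)
  have hs := integral_sub hi2 hi1
  rw [hz, sub_zero] at hs
  rw [← hs]
  refine integral_nonneg_of_ae (ae_Om.mono fun p hp => ?_)
  have hne : p.1 + ε ≠ 0 := by have := hp.1; positivity
  have : du p ^ 2 + (m ^ 2 - m) * (1 / (p.1 + ε) ^ 2 * u p * u p)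
      - 2 * m * k * (1 / (p.1 + ε) * u p * u p) + k ^ 2 * u p ^ 2
      - (-m / (p.1 + ε) ^ 2 * u p * u p + 2 * ((m / (p.1 + ε) - k) * u p * du p))
      = (du p - (m / (p.1 + ε) - k) * u p) ^ 2 := by
    field_simp
    ring
  simpa only [Pi.zero_apply, this] using sq_nonneg _

theorem integrable_inv_sq (h : IsH1Left u du) :
    IntegrableOn (fun p => 1 / p.1 ^ 2 * u p * u p) Om := by
  refine (integrable_and_integral_le_of_tendsto (K := 4 * ∫ p in Om, du p ^ 2)
    (g := fun (n : ℕ) p => 1 / (p.1 + 1 / ((n : ℝ) + 1)) ^ 2 * u p * u p)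
    (fun n => (h.integrable_inv_add Nat.one_div_pos_of_nat).2)
    (fun n => Filter.Eventually.of_forall fun p => ?_) (fun n => ?_) (ae_Om.mono fun p hp => ?_)).1
  · simp only [Pi.zero_apply, mul_assoc]
    exact mul_nonneg (by positivity) (mul_self_nonneg _)
  · have h1 := h.regularized_nonneg (1 / 2) 0 (Nat.one_div_pos_of_nat (n := n) (α := ℝ))
    have h2 := (h.integrable_inv_add (Nat.one_div_pos_of_nat (n := n) (α := ℝ))).2
    have h3 : ∫ p in Om, (du p ^ 2 + ((1 / 2) ^ 2 - 1 / 2) *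
          (1 / (p.1 + 1 / ((n : ℝ) + 1)) ^ 2 * u p * u p)
        - 2 * (1 / 2) * 0 * (1 / (p.1 + 1 / ((n : ℝ) + 1)) * u p * u p) + 0 ^ 2 * u p ^ 2)
        = (∫ p in Om, du p ^ 2) + ((1 / 2) ^ 2 - 1 / 2) *
          ∫ p in Om, 1 / (p.1 + 1 / ((n : ℝ) + 1)) ^ 2 * u p * u p := by
      rw [← integral_const_mul, ← integral_add h.integrable_deriv_sq (h2.const_mul _)]
      simp
    rw [h3] at h1
    linarith
  · have := hp.1
    exact ((((tendsto_const_nhds.div ((tendsto_add_inv p.1).pow 2) (by positivity)))).mul_const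
      (u p)).mul_const (u p)

theorem integrable_inv (h : IsH1Left u du) :
    IntegrableOn (fun p => 1 / p.1 * u p * u p) Om := by
  refine (h.integrable_inv_sq.add h.integrable_sq).mono' ?_ (ae_Om.mono fun p hp => ?_)
  · have := h.measurable
    exact Measurable.aestronglyMeasurable (by fun_prop)
  · have h1 := hp.1
    rw [Real.norm_of_nonneg (by rw [mul_assoc]; exact mul_nonneg (by positivity) (mul_self_nonneg _))]
    simp only [Pi.add_apply]
    have : 1 / p.1 ^ 2 * u p * u p + u p ^ 2 - 1 / p.1 * u p * u p
        = ((1 / p.1 - 1 / 2) ^ 2 + 3 / 4) * u p ^ 2 := by field_simp; ring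
    have : 0 ≤ ((1 / p.1 - 1 / 2) ^ 2 + 3 / 4) * u p ^ 2 := by positivity
    linarith

theorem nonneg (h : IsH1Left u du) (m k : ℝ) :
    0 ≤ (∫ p in Om, du p ^ 2) + (m ^ 2 - m) * (∫ p in Om, 1 / p.1 ^ 2 * u p * u p)
      - 2 * m * k * (∫ p in Om, 1 / p.1 * u p * u p) + k ^ 2 * ∫ p in Om, u p ^ 2 := by
  have hm := h.measurable
  have hε : ∀ n : ℕ, 0 < 1 / ((n : ℝ) + 1) := fun n => Nat.one_div_pos_of_nat
  have l2 : Filter.Tendsto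
      (fun n : ℕ => ∫ p in Om, 1 / (p.1 + 1 / ((n : ℝ) + 1)) ^ 2 * u p * u p) Filter.atTop
      (nhds (∫ p in Om, 1 / p.1 ^ 2 * u p * u p)) := by
    refine tendsto_integral_of_dominated_convergence _
      (fun n => (h.integrable_inv_add (hε n)).2.1) h.integrable_inv_sq
      (fun n => ae_Om.mono fun p hp => ?_) (ae_Om.mono fun p hp => ?_)
    · have h1 := hp.1
      have h2 := hε n
      rw [Real.norm_of_nonneg
        (by rw [mul_assoc]; exact mul_nonneg (by positivity) (mul_self_nonneg _)),
        mul_assoc, mul_assoc]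
      refine mul_le_mul_of_nonneg_right ?_ (mul_self_nonneg _)
      gcongr; linarith
    · have := hp.1
      exact ((((tendsto_const_nhds.div ((tendsto_add_inv p.1).pow 2) (by positivity)))).mul_const
        (u p)).mul_const (u p)
  have l1 : Filter.Tendsto
      (fun n : ℕ => ∫ p in Om, 1 / (p.1 + 1 / ((n : ℝ) + 1)) * u p * u p) Filter.atTop
      (nhds (∫ p in Om, 1 / p.1 * u p * u p)) := by
    refine tendsto_integral_of_dominated_convergence _
      (fun n => (h.integrable_inv_add (hε n)).1.1) h.integrable_inv
      (fun n => ae_Om.mono fun p hp => ?_) (ae_Om.mono fun p hp => ?_)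
    · have h1 := hp.1
      have h2 := hε n
      rw [Real.norm_of_nonneg
        (by rw [mul_assoc]; exact mul_nonneg (by positivity) (mul_self_nonneg _)),
        mul_assoc, mul_assoc]
      refine mul_le_mul_of_nonneg_right ?_ (mul_self_nonneg _)
      gcongr; linarith
    · exact ((((tendsto_const_nhds.div (tendsto_add_inv p.1) hp.1.ne'))).mul_const
        (u p)).mul_const (u p)
  refine ge_of_tendsto' (((tendsto_const_nhds.add (l2.const_mul (m ^ 2 - m))).sub
    (l1.const_mul (2 * m * k))).add tendsto_const_nhds) fun n => ?_
  have i1 := h.integrable_deriv_sq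
  have i2 := (h.integrable_inv_add (hε n)).2.const_mul (m ^ 2 - m)
  have i3 := (h.integrable_inv_add (hε n)).1.const_mul (2 * m * k)
  have i4 := h.integrable_sq.const_mul (k ^ 2)
  refine (h.regularized_nonneg m k (hε n)).trans_eq ?_
  rw [← integral_const_mul, ← integral_const_mul, ← integral_const_mul]
  exact (integral_add ((i1.add i2).sub i3) i4).trans (congrArg (· + _)
    ((integral_sub (i1.add i2) i3).trans (congrArg (· - _) (integral_add i1 i2))))

end IsH1Left

namespace IsH1Left

variable {u du : ℝ × ℝ → ℝ}

theorem integrable_kappa (h : IsH1Left u du) (l : ℕ) :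
    IntegrableOn (fun p => kappa l p.1 * u p * u p) Om ∧
    ∫ p in Om, kappa l p.1 * u p * u p =
      ((l : ℝ) * (l + 1) / 2) * (∫ p in Om, 1 / p.1 ^ 2 * u p * u p)
        - (∫ p in Om, 1 / p.1 * u p * u p) + 1 / 2 * ∫ p in Om, u p ^ 2 := by
  have i1 := h.integrable_inv_sq.const_mul ((l : ℝ) * (l + 1) / 2)
  have i2 := h.integrable_inv
  have i3 := h.integrable_sq.const_mul (1 / 2)
  have e : (fun p => kappa l p.1 * u p * u p) =
      ((fun p => (l : ℝ) * (l + 1) / 2 * (1 / p.1 ^ 2 * u p * u p))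
        - (fun p => 1 / p.1 * u p * u p)) + (fun p => 1 / 2 * u p ^ 2) := by
    ext p
    simp only [kappa, Pi.add_apply, Pi.sub_apply, div_eq_mul_inv, mul_inv]
    ring
  constructor
  · rw [e]
    exact (i1.sub i2).add i3
  · rw [← integral_const_mul, ← integral_const_mul, e]
    exact (integral_add (i1.sub i2) i3).trans (congrArg (· + _) (integral_sub i1 i2))

theorem integral_inv_sq_nonneg : 0 ≤ ∫ p in Om, 1 / p.1 ^ 2 * u p * u p :=
  integral_nonneg fun p => by
    simp only [Pi.zero_apply, mul_assoc]
    exact mul_nonneg (by positivity) (mul_self_nonneg _)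

theorem energy_nonneg (h : IsH1Left u du) (l : ℕ) :
    0 ≤ 1 / 2 * (∫ p in Om, du p ^ 2) + ∫ p in Om, kappa l p.1 * u p * u p := by
  rw [(h.integrable_kappa l).2]
  have h1 := h.nonneg 1 1
  have h2 : 0 ≤ ((l : ℝ) * (l + 1) / 2) * ∫ p in Om, 1 / p.1 ^ 2 * u p * u p :=
    mul_nonneg (by positivity) integral_inv_sq_nonneg
  linarith

theorem energy_ge (h : IsH1Left u du) {l : ℕ} (hl : l ≠ 0) :
    3 / 8 * (∫ p in Om, u p ^ 2) ≤
      1 / 2 * (∫ p in Om, du p ^ 2) + ∫ p in Om, kappa l p.1 * u p * u p := by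
  rw [(h.integrable_kappa l).2]
  have h1 := h.nonneg 2 (1 / 2)
  have hl' : (1 : ℝ) ≤ l := by exact_mod_cast Nat.one_le_iff_ne_zero.2 hl
  have h2 : 0 ≤ ((l : ℝ) * (l + 1) / 2 - 1) * ∫ p in Om, 1 / p.1 ^ 2 * u p * u p :=
    mul_nonneg (by nlinarith) integral_inv_sq_nonneg
  linarith

theorem energy_ge_deriv (h : IsH1Left u du) (l : ℕ) :
    1 / 4 * (∫ p in Om, du p ^ 2) - 1 / 2 * (∫ p in Om, u p ^ 2) ≤
      1 / 2 * (∫ p in Om, du p ^ 2) + ∫ p in Om, kappa l p.1 * u p * u p := by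
  rw [(h.integrable_kappa l).2]
  have h1 := h.nonneg 1 2
  have h2 : 0 ≤ ((l : ℝ) * (l + 1) / 2) * ∫ p in Om, 1 / p.1 ^ 2 * u p * u p :=
    mul_nonneg (by positivity) integral_inv_sq_nonneg
  linarith

end IsH1Left

theorem swap_preimage_Om : Prod.swap ⁻¹' Om = Om := Set.preimage_swap_prod _ _

theorem measurePreserving_swap_volume :
    MeasurePreserving (Prod.swap : ℝ × ℝ → ℝ × ℝ) volume volume :=
  Measure.measurePreserving_swap

theorem setIntegral_Om_swap (g : ℝ × ℝ → ℝ) : ∫ p in Om, g p.swap = ∫ p in Om, g p := by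
  have := measurePreserving_swap_volume.setIntegral_preimage_emb
    MeasurableEquiv.prodComm.measurableEmbedding g Om
  rwa [swap_preimage_Om] at this

theorem integrableOn_Om_swap {g : ℝ × ℝ → ℝ} :
    IntegrableOn (fun p => g p.swap) Om ↔ IntegrableOn g Om := by
  have := measurePreserving_swap_volume.integrableOn_comp_preimage (f := g) (s := Om)
    MeasurableEquiv.prodComm.measurableEmbedding
  rwa [swap_preimage_Om] at this

namespace MemH10

variable {v : ℝ × ℝ → ℝ}

theorem measurable (h : MemH10 v) : Measurable v := by
  classical
  have : Om.piecewise v 0 = v := by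
    ext p
    by_cases hp : p ∈ Om
    · simp [hp]
    · simp [hp, h.2.1 p hp]
  rw [← this]
  exact (h.1.mono subset_closure).measurable_piecewise continuousOn_const isOpen_Om.measurableSet

theorem differentiableAt (h : MemH10 v) {p : ℝ × ℝ} (hp : p ∈ Om) : DifferentiableAt ℝ v p :=
  (h.2.2.1 p hp).differentiableAt (isOpen_Om.mem_nhds hp)

theorem integrable_sq (h : MemH10 v) : IntegrableOn (fun p => v p ^ 2) Om := h.2.2.2.1

theorem integrable_fst_sq (h : MemH10 v) :
    IntegrableOn (fun p => (fderiv ℝ v p (1, 0)) ^ 2) Om := by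
  refine h.2.2.2.2.mono'
    ((measurable_fderiv_apply_const ℝ v (1, 0)).pow_const 2).aestronglyMeasurable
    (Filter.Eventually.of_forall fun p => ?_)
  rw [Real.norm_of_nonneg (sq_nonneg _)]
  linarith [sq_nonneg (fderiv ℝ v p (0, 1))]

theorem integrable_snd_sq (h : MemH10 v) :
    IntegrableOn (fun p => (fderiv ℝ v p (0, 1)) ^ 2) Om := by
  refine h.2.2.2.2.mono'
    ((measurable_fderiv_apply_const ℝ v (0, 1)).pow_const 2).aestronglyMeasurable
    (Filter.Eventually.of_forall fun p => ?_)
  rw [Real.norm_of_nonneg (sq_nonneg _)]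
  linarith [sq_nonneg (fderiv ℝ v p (1, 0))]

theorem isH1Left (h : MemH10 v) : IsH1Left v (fun p => fderiv ℝ v p (1, 0)) where
  hasDerivAt x hx y hy :=
    (h.differentiableAt (p := (x, y)) ⟨hx, hy⟩).hasFDerivAt.comp_hasDerivAt x
      ((hasDerivAt_id x).prodMk (hasDerivAt_const x y))
  continuousWithinAt y hy := by
    have h0 : ((0 : ℝ), y) ∈ closure Om := by
      rw [closure_Om]; exact ⟨Set.self_mem_Ici, le_of_lt hy⟩
    refine (h.1 (0, y) h0).comp (f := fun t : ℝ => (t, y))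
      (by fun_prop : Continuous fun t : ℝ => (t, y)).continuousWithinAt fun t ht => ?_
    rw [closure_Om]
    exact ⟨ht, le_of_lt hy⟩
  zero y _ := h.2.1 _ fun hp => lt_irrefl (0 : ℝ) hp.1
  measurable := h.measurable
  measurable_deriv := measurable_fderiv_apply_const ℝ v (1, 0)
  integrable_sq := h.integrable_sq
  integrable_deriv_sq := h.integrable_fst_sq

theorem isH1Left_swap (h : MemH10 v) :
    IsH1Left (fun p => v p.swap) (fun p => fderiv ℝ v p.swap (0, 1)) where
  hasDerivAt x hx y hy :=
    (h.differentiableAt (p := (y, x)) ⟨hy, hx⟩).hasFDerivAt.comp_hasDerivAt x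
      ((hasDerivAt_const x y).prodMk (hasDerivAt_id x))
  continuousWithinAt y hy := by
    have h0 : (y, (0 : ℝ)) ∈ closure Om := by
      rw [closure_Om]; exact ⟨le_of_lt hy, Set.self_mem_Ici⟩
    refine (h.1 (y, 0) h0).comp (f := fun t : ℝ => (y, t))
      (by fun_prop : Continuous fun t : ℝ => (y, t)).continuousWithinAt fun t ht => ?_
    rw [closure_Om]
    exact ⟨le_of_lt hy, ht⟩
  zero y _ := h.2.1 _ fun hp => lt_irrefl (0 : ℝ) hp.2
  measurable := h.measurable.comp measurable_swap
  measurable_deriv := (measurable_fderiv_apply_const ℝ v (0, 1)).comp measurable_swap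
  integrable_sq := integrableOn_Om_swap.2 h.integrable_sq
  integrable_deriv_sq := integrableOn_Om_swap.2 h.integrable_snd_sq

theorem energy_eq (h : MemH10 v) (l₁ l₂ : ℕ) :
    1 / 2 * (∫ p in Om, ((fderiv ℝ v p (1, 0)) ^ 2 + (fderiv ℝ v p (0, 1)) ^ 2))
        + ∫ p in Om, (kappa l₁ p.1 + kappa l₂ p.2) * v p * v p =
      (1 / 2 * (∫ p in Om, (fderiv ℝ v p (1, 0)) ^ 2) + ∫ p in Om, kappa l₁ p.1 * v p * v p) +
      (1 / 2 * (∫ p in Om, (fderiv ℝ v p.swap (0, 1)) ^ 2)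
        + ∫ p in Om, kappa l₂ p.1 * v p.swap * v p.swap) := by
  have i1 := (h.isH1Left.integrable_kappa l₁).1
  have i2 : IntegrableOn (fun p => kappa l₂ p.2 * v p * v p) Om :=
    integrableOn_Om_swap.1 (h.isH1Left_swap.integrable_kappa l₂).1
  have e : ∫ p in Om, kappa l₂ p.1 * v p.swap * v p.swap =
      ∫ p in Om, kappa l₂ p.2 * v p * v p :=
    setIntegral_Om_swap (fun p => kappa l₂ p.2 * v p * v p)
  rw [setIntegral_Om_swap (fun p => (fderiv ℝ v p (0, 1)) ^ 2), e,
    integral_add h.integrable_fst_sq h.integrable_snd_sq]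
  simp only [add_mul]
  rw [integral_add i1 i2]
  ring

theorem energy_ge (h : MemH10 v) {l₁ l₂ : ℕ} (hl : (l₁, l₂) ≠ (0, 0)) :
    3 / 8 * (∫ p in Om, v p ^ 2) ≤
    1 / 2 * (∫ p in Om, ((fderiv ℝ v p (1, 0)) ^ 2 + (fderiv ℝ v p (0, 1)) ^ 2))
        + ∫ p in Om, (kappa l₁ p.1 + kappa l₂ p.2) * v p * v p := by
  rw [h.energy_eq]
  by_cases h1 : l₁ = 0
  · have h2 : l₂ ≠ 0 := fun h2 => hl (by rw [h1, h2])
    have := h.isH1Left_swap.energy_ge h2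
    rw [setIntegral_Om_swap (fun p => v p ^ 2)] at this
    linarith [h.isH1Left.energy_nonneg l₁]
  · linarith [h.isH1Left.energy_ge h1, h.isH1Left_swap.energy_nonneg l₂]

theorem energy_ge_grad (h : MemH10 v) (l₁ l₂ : ℕ) :
    1 / 4 * (∫ p in Om, ((fderiv ℝ v p (1, 0)) ^ 2 + (fderiv ℝ v p (0, 1)) ^ 2))
      - (∫ p in Om, v p ^ 2) ≤
    1 / 2 * (∫ p in Om, ((fderiv ℝ v p (1, 0)) ^ 2 + (fderiv ℝ v p (0, 1)) ^ 2))
        + ∫ p in Om, (kappa l₁ p.1 + kappa l₂ p.2) * v p * v p := by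
  rw [h.energy_eq, integral_add h.integrable_fst_sq h.integrable_snd_sq]
  have h1 := h.isH1Left.energy_ge_deriv l₁
  have h2 := h.isH1Left_swap.energy_ge_deriv l₂
  rw [setIntegral_Om_swap (fun p => v p ^ 2)] at h2
  have h3 := setIntegral_Om_swap (fun p => (fderiv ℝ v p (0, 1)) ^ 2)
  linarith

end MemH10

theorem fderiv_exp_mul {s d₁ d₂ : ℝ} {γ : ℝ → ℝ} {v : ℝ × ℝ → ℝ} {p : ℝ × ℝ}
    (h₁ : HasDerivAt γ d₁ p.1) (h₂ : HasDerivAt γ d₂ p.2) (hv : DifferentiableAt ℝ v p) :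
    DifferentiableAt ℝ (fun q : ℝ × ℝ => Real.exp (s * (γ q.1 + γ q.2)) * v q) p ∧
    fderiv ℝ (fun q : ℝ × ℝ => Real.exp (s * (γ q.1 + γ q.2)) * v q) p (1, 0) =
      Real.exp (s * (γ p.1 + γ p.2)) * (fderiv ℝ v p (1, 0) + s * d₁ * v p) ∧
    fderiv ℝ (fun q : ℝ × ℝ => Real.exp (s * (γ q.1 + γ q.2)) * v q) p (0, 1) =
      Real.exp (s * (γ p.1 + γ p.2)) * (fderiv ℝ v p (0, 1) + s * d₂ * v p) := by
  have H := (((h₁.comp_hasFDerivAt p hasFDerivAt_fst).add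
    (h₂.comp_hasFDerivAt p hasFDerivAt_snd)).const_mul s).exp.mul hv.hasFDerivAt
  have H' : HasFDerivAt (fun q : ℝ × ℝ => Real.exp (s * (γ q.1 + γ q.2)) * v q) _ p := H
  refine ⟨H'.differentiableAt, ?_, ?_⟩
  · rw [H'.fderiv]
    simp
    ring
  · rw [H'.fderiv]
    simp
    ring

/-- The bounded approximation `r / (1 + ε r)` of the identity on `[0,∞)`. -/
noncomputable def truncId (ε r : ℝ) : ℝ := r / (1 + ε * r)

section truncId

variable {ε r : ℝ}

theorem truncId_hasDerivAt (hε : 0 < ε) (hr : 0 ≤ r) :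
    HasDerivAt (truncId ε) (1 / (1 + ε * r) ^ 2) r := by
  have hne : 1 + ε * r ≠ 0 := by positivity
  exact ((hasDerivAt_id r).div (((hasDerivAt_id r).const_mul ε).const_add 1) hne).congr_deriv
    (by simp; ring)

theorem truncId_deriv_le_one (hε : 0 < ε) (hr : 0 ≤ r) : 1 / (1 + ε * r) ^ 2 ≤ 1 := by
  have : 1 ≤ (1 + ε * r) ^ 2 := one_le_pow₀ (by nlinarith)
  rw [div_le_one (by positivity)]
  exact this

theorem truncId_le (hε : 0 < ε) (hr : 0 ≤ r) : truncId ε r ≤ r :=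
  div_le_self hr (by nlinarith)

theorem truncId_le_inv (hε : 0 < ε) (hr : 0 ≤ r) : truncId ε r ≤ 1 / ε := by
  rw [truncId, div_le_div_iff₀ (by positivity) hε]
  nlinarith

theorem continuousOn_truncId (hε : 0 < ε) : ContinuousOn (truncId ε) (Set.Ici 0) :=
  fun _ hr => (truncId_hasDerivAt hε hr).continuousAt.continuousWithinAt

end truncId

/-- The function `v` multiplied by the bounded exponential weight
`exp (s (truncId ε r₁ + truncId ε r₂))`. -/
noncomputable def expTrunc (ε s : ℝ) (v : ℝ × ℝ → ℝ) (p : ℝ × ℝ) : ℝ :=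
  Real.exp (s * (truncId ε p.1 + truncId ε p.2)) * v p

theorem MemH10.fderiv_expTrunc {v : ℝ × ℝ → ℝ} (h : MemH10 v) {ε : ℝ} (hε : 0 < ε) (s : ℝ)
    {p : ℝ × ℝ} (hp : p ∈ Om) :
    DifferentiableAt ℝ (expTrunc ε s v) p ∧
    fderiv ℝ (expTrunc ε s v) p (1, 0) = Real.exp (s * (truncId ε p.1 + truncId ε p.2)) *
      (fderiv ℝ v p (1, 0) + s * (1 / (1 + ε * p.1) ^ 2) * v p) ∧
    fderiv ℝ (expTrunc ε s v) p (0, 1) = Real.exp (s * (truncId ε p.1 + truncId ε p.2)) *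
      (fderiv ℝ v p (0, 1) + s * (1 / (1 + ε * p.2) ^ 2) * v p) :=
  fderiv_exp_mul (truncId_hasDerivAt hε (le_of_lt hp.1)) (truncId_hasDerivAt hε (le_of_lt hp.2))
    (h.differentiableAt hp)

theorem exp_mul_add_sq_le {E M a s d b : ℝ} (hE : 0 ≤ E) (hEM : E ≤ M) (hd0 : 0 ≤ d)
    (hd : d ≤ 1) :
    (E * (a + s * d * b)) ^ 2 ≤ M ^ 2 * (2 * a ^ 2 + 2 * s ^ 2 * b ^ 2) := by
  have h1 : E ^ 2 ≤ M ^ 2 := pow_le_pow_left₀ hE hEM 2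
  have h2 : d ^ 2 ≤ 1 := pow_le_one₀ hd0 hd
  have h3 : (a + s * d * b) ^ 2 ≤ 2 * a ^ 2 + 2 * s ^ 2 * b ^ 2 := by
    have : d ^ 2 * (s * b) ^ 2 ≤ 1 * (s * b) ^ 2 := mul_le_mul_of_nonneg_right h2 (sq_nonneg _)
    nlinarith [sq_nonneg (a - s * d * b)]
  rw [mul_pow]
  exact mul_le_mul h1 h3 (sq_nonneg _) (sq_nonneg _)

theorem MemH10.memH10_expTrunc {v : ℝ × ℝ → ℝ} (h : MemH10 v) {ε s : ℝ} (hε : 0 < ε) (hs : 0 ≤ s) :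
    MemH10 (expTrunc ε s v) := by
  set M := Real.exp (s * (1 / ε + 1 / ε))
  have hM : ∀ p ∈ Om, Real.exp (s * (truncId ε p.1 + truncId ε p.2)) ≤ M := fun p hp => by
    have h1 := truncId_le_inv hε (le_of_lt hp.1)
    have h2 := truncId_le_inv hε (le_of_lt hp.2)
    exact Real.exp_le_exp.2 (mul_le_mul_of_nonneg_left (add_le_add h1 h2) hs)
  have hc : ContinuousOn (expTrunc ε s v) (closure Om) := by
    refine ContinuousOn.mul (Real.continuous_exp.comp_continuousOn
      (continuousOn_const.mul (ContinuousOn.add ?_ ?_))) h.1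
    · exact (continuousOn_truncId hε).comp continuous_fst.continuousOn fun p hp => by
        rw [closure_Om] at hp; exact hp.1
    · exact (continuousOn_truncId hε).comp continuous_snd.continuousOn fun p hp => by
        rw [closure_Om] at hp; exact hp.2
  have hom := isOpen_Om.measurableSet
  refine ⟨hc, fun p hp => ?_, fun p hp => (h.fderiv_expTrunc hε s hp).1.differentiableWithinAt,
    ?_, ?_⟩
  · rw [expTrunc, h.2.1 p hp, mul_zero]
  · refine (h.integrable_sq.const_mul (M ^ 2)).mono'
      (((hc.mono subset_closure).aestronglyMeasurable hom).pow 2)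
      ((ae_restrict_mem hom).mono fun p hp => ?_)
    rw [Real.norm_of_nonneg (sq_nonneg _), expTrunc, mul_pow]
    exact mul_le_mul_of_nonneg_right (pow_le_pow_left₀ (Real.exp_nonneg _) (hM p hp) 2)
      (sq_nonneg _)
  · refine (((h.integrable_fst_sq.const_mul 2).add (h.integrable_sq.const_mul (2 * s ^ 2))).const_mul
      (M ^ 2) |>.add (((h.integrable_snd_sq.const_mul 2).add
        (h.integrable_sq.const_mul (2 * s ^ 2))).const_mul (M ^ 2))).mono'
      (((measurable_fderiv_apply_const ℝ _ (1, 0)).pow_const 2).add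
        ((measurable_fderiv_apply_const ℝ _ (0, 1)).pow_const 2)).aestronglyMeasurable
      ((ae_restrict_mem hom).mono fun p hp => ?_)
    rw [Real.norm_of_nonneg (by positivity), (h.fderiv_expTrunc hε s hp).2.1,
      (h.fderiv_expTrunc hε s hp).2.2]
    exact add_le_add
      (exp_mul_add_sq_le (Real.exp_nonneg _) (hM p hp) (by positivity)
        (truncId_deriv_le_one hε (le_of_lt hp.1)))
      (exp_mul_add_sq_le (Real.exp_nonneg _) (hM p hp) (by positivity)
        (truncId_deriv_le_one hε (le_of_lt hp.2)))

theorem MemH10.energy_expTrunc_le {T : ℝ × ℝ → ℝ} (h : MemH10 T) {α ε : ℝ} (hα : 0 ≤ α)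
    (hε : 0 < ε) (l₁ l₂ : ℕ) :
    1 / 2 * (∫ p in Om, ((fderiv ℝ (expTrunc ε α T) p (1, 0)) ^ 2
          + (fderiv ℝ (expTrunc ε α T) p (0, 1)) ^ 2))
        + ∫ p in Om, (kappa l₁ p.1 + kappa l₂ p.2) *
          expTrunc ε α T p * expTrunc ε α T p ≤
      aform l₁ l₂ T (expTrunc ε (2 * α) T)
        + α ^ 2 * ∫ p in Om, expTrunc ε α T p ^ 2 := by
  have hu := h.memH10_expTrunc hε hα
  have hom := isOpen_Om.measurableSet
  have hsq : ∀ p : ℝ × ℝ, Real.exp (2 * α * (truncId ε p.1 + truncId ε p.2)) =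
      Real.exp (α * (truncId ε p.1 + truncId ε p.2)) ^ 2 := fun p => by
    rw [← Real.exp_nat_mul]; congr 1; push_cast; ring
  have hpot : ∫ p in Om, (kappa l₁ p.1 + kappa l₂ p.2) * T p * expTrunc ε (2 * α) T p =
      ∫ p in Om, (kappa l₁ p.1 + kappa l₂ p.2) *
        expTrunc ε α T p * expTrunc ε α T p := by
    congr 1
    ext p
    rw [expTrunc, expTrunc, hsq]
    ring
  set d : ℝ × ℝ → ℝ := fun p => (1 / (1 + ε * p.1) ^ 2) ^ 2 + (1 / (1 + ε * p.2) ^ 2) ^ 2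
  have hd : ∀ p ∈ Om, |d p| ≤ 2 := fun p hp => by
    have h1 := pow_le_one₀ (n := 2) (by positivity) (truncId_deriv_le_one hε (le_of_lt hp.1))
    have h2 := pow_le_one₀ (n := 2) (by positivity) (truncId_deriv_le_one hε (le_of_lt hp.2))
    rw [abs_of_nonneg (by positivity)]
    linarith
  have hgrad : ∀ p ∈ Om, fderiv ℝ T p (1, 0) * fderiv ℝ (expTrunc ε (2 * α) T) p (1, 0)
      + fderiv ℝ T p (0, 1) * fderiv ℝ (expTrunc ε (2 * α) T) p (0, 1) =
      ((fderiv ℝ (expTrunc ε α T) p (1, 0)) ^ 2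
          + (fderiv ℝ (expTrunc ε α T) p (0, 1)) ^ 2)
        - α ^ 2 * (d p * expTrunc ε α T p * expTrunc ε α T p) := fun p hp => by
    rw [(h.fderiv_expTrunc hε _ hp).2.1, (h.fderiv_expTrunc hε _ hp).2.2,
      (h.fderiv_expTrunc hε _ hp).2.1, (h.fderiv_expTrunc hε _ hp).2.2, hsq, expTrunc]
    ring
  have hdm : Measurable d := by fun_prop
  have hdu : IntegrableOn (fun p => d p * expTrunc ε α T p * expTrunc ε α T p) Om :=
    integrable_mul_mul_of_sq hdm.aestronglyMeasurable ((ae_restrict_mem hom).mono hd)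
      hu.measurable.aestronglyMeasurable hu.measurable.aestronglyMeasurable
      hu.integrable_sq hu.integrable_sq
  have hdle : ∫ p in Om, d p * expTrunc ε α T p * expTrunc ε α T p ≤
      2 * ∫ p in Om, expTrunc ε α T p ^ 2 := by
    rw [← integral_const_mul]
    refine setIntegral_mono_on hdu (hu.integrable_sq.const_mul 2) hom fun p hp => ?_
    rw [mul_assoc, ← sq]
    exact mul_le_mul_of_nonneg_right ((le_abs_self _).trans (hd p hp)) (sq_nonneg _)
  rw [aform, hpot, setIntegral_congr_fun hom hgrad, integral_sub hu.2.2.2.2 (hdu.const_mul _),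
    integral_const_mul]
  nlinarith [mul_le_mul_of_nonneg_left hdle (sq_nonneg α)]

theorem integral_mul_expTrunc_le {T f : ℝ × ℝ → ℝ} (h : MemH10 T) {α η ε c : ℝ} (hα : 0 ≤ α)
    (hη : α ≤ η) (hε : 0 < ε) (hc : 0 < c)
    (hf : IntegrableOn (fun p => (Real.exp (η * (p.1 + p.2)) * f p) ^ 2) Om) :
    ∫ p in Om, f p * expTrunc ε (2 * α) T p ≤ c / 2 * (∫ p in Om, expTrunc ε α T p ^ 2)
      + 1 / (2 * c) * ∫ p in Om, (Real.exp (η * (p.1 + p.2)) * f p) ^ 2 := by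
  have hu := (h.memH10_expTrunc hε hα).integrable_sq
  by_cases hi : IntegrableOn (fun p => f p * expTrunc ε (2 * α) T p) Om
  · rw [← integral_const_mul, ← integral_const_mul,
      ← integral_add (hu.const_mul _) (hf.const_mul _)]
    refine setIntegral_mono_on hi ((hu.const_mul _).add (hf.const_mul _))
      isOpen_Om.measurableSet fun p hp => ?_
    set E := Real.exp (α * (truncId ε p.1 + truncId ε p.2)) with hE
    have hsq : Real.exp (2 * α * (truncId ε p.1 + truncId ε p.2)) = E ^ 2 := by
      rw [hE, ← Real.exp_nat_mul]; congr 1; push_cast; ring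
    have hle : E ≤ Real.exp (η * (p.1 + p.2)) := by
      have h1 : 0 < p.1 := hp.1
      have h2 : 0 < p.2 := hp.2
      refine Real.exp_le_exp.2 ((mul_le_mul_of_nonneg_left
        (add_le_add (truncId_le hε h1.le) (truncId_le hε h2.le)) hα).trans ?_)
      exact mul_le_mul_of_nonneg_right hη (by positivity)
    have h1 : (E * f p) ^ 2 ≤ (Real.exp (η * (p.1 + p.2)) * f p) ^ 2 := by
      rw [mul_pow, mul_pow]
      exact mul_le_mul_of_nonneg_right (pow_le_pow_left₀ (Real.exp_nonneg _) hle 2) (sq_nonneg _)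
    have h2 : f p * (E ^ 2 * T p) ≤ c / 2 * (E * T p) ^ 2 + 1 / (2 * c) * (E * f p) ^ 2 := by
      have : c / 2 * (E * T p) ^ 2 + 1 / (2 * c) * (E * f p) ^ 2 - f p * (E ^ 2 * T p)
          = 1 / (2 * c) * (c * (E * T p) - E * f p) ^ 2 := by field_simp; ring
      have : 0 ≤ 1 / (2 * c) * (c * (E * T p) - E * f p) ^ 2 := by positivity
      linarith
    have h3 := mul_le_mul_of_nonneg_left h1 (by positivity : 0 ≤ 1 / (2 * c))
    simp only [expTrunc, hsq]
    linarith
  · rw [integral_undef hi]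
    have h1 : 0 ≤ ∫ p in Om, expTrunc ε α T p ^ 2 := integral_nonneg fun _ => sq_nonneg _
    have h2 : 0 ≤ ∫ p in Om, (Real.exp (η * (p.1 + p.2)) * f p) ^ 2 :=
      integral_nonneg fun _ => sq_nonneg _
    positivity

theorem exists_integral_expTrunc_le {α : ℝ} (hα0 : 0 ≤ α) (hα : α ^ 2 < 3 / 8) :
    ∃ K : ℝ, 0 ≤ K ∧ ∀ (l₁ l₂ : ℕ), (l₁, l₂) ≠ (0, 0) → ∀ η : ℝ, α ≤ η →
      ∀ f : ℝ × ℝ → ℝ, IntegrableOn (fun p => (Real.exp (η * (p.1 + p.2)) * f p) ^ 2) Om →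
      ∀ T : ℝ × ℝ → ℝ, MemH10 T →
        (∀ w : ℝ × ℝ → ℝ, MemH10 w → aform l₁ l₂ T w = ∫ p in Om, f p * w p) →
      ∀ ε > 0, ∫ p in Om, (expTrunc ε α T p ^ 2 + fderiv ℝ (expTrunc ε α T) p (1, 0) ^ 2
          + fderiv ℝ (expTrunc ε α T) p (0, 1) ^ 2)
        ≤ K * ∫ p in Om, (Real.exp (η * (p.1 + p.2)) * f p) ^ 2 := by
  set c := 3 / 8 - α ^ 2 with hc_def
  have hc : 0 < c := by rw [hc_def]; linarith
  refine ⟨(1 + 4 * (1 + α ^ 2 + c / 2)) * (1 / c ^ 2) + 4 * (1 / (2 * c)), by positivity, ?_⟩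
  intro l₁ l₂ hl η hη f hf T hT hweak ε hε
  have hu := hT.memH10_expTrunc hε hα0
  have h1 := hT.energy_expTrunc_le hα0 hε l₁ l₂
  rw [hweak _ (hT.memH10_expTrunc hε (by positivity))] at h1
  have h2 := integral_mul_expTrunc_le hT hα0 hη hε hc hf
  have h3 := hu.energy_ge hl
  have h4 := hu.energy_ge_grad l₁ l₂
  simp only [add_assoc]
  rw [integral_add hu.integrable_sq hu.2.2.2.2]
  set U := ∫ p in Om, expTrunc ε α T p ^ 2
  set F := ∫ p in Om, (Real.exp (η * (p.1 + p.2)) * f p) ^ 2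
  have hU : U ≤ 1 / c ^ 2 * F := by
    have : c / 2 * U ≤ 1 / (2 * c) * F := by rw [hc_def] at h2 ⊢; linarith
    calc U = 2 / c * (c / 2 * U) := by field_simp
      _ ≤ 2 / c * (1 / (2 * c) * F) := mul_le_mul_of_nonneg_left this (by positivity)
      _ = 1 / c ^ 2 * F := by field_simp
  have hU' := mul_le_mul_of_nonneg_left hU (by positivity : 0 ≤ 1 + 4 * (1 + α ^ 2 + c / 2))
  linarith

/-- Exponential decay of solutions of the modified Slater--Kirkwood problem:
for `0 ≤ α < √(3/8)` there is a constant `C_α`, independent of `l₁, l₂, f, η`,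
such that for `(l₁,l₂) ≠ (0,0)`, `η > α`, `f` with `‖e^{η(r₁+r₂)}f‖_{L²(Ω)} < ∞`,
any weak solution `T ∈ H¹₀(Ω)` of `-(1/2)ΔT + (κ_{l₁}(r₁)+κ_{l₂}(r₂))T = f`
satisfies `‖e^{α(r₁+r₂)}T‖_{H¹(Ω)} ≤ C_α ‖e^{η(r₁+r₂)}f‖_{L²(Ω)}`. -/
theorem exponential_decay_of_solution
    (α : ℝ) (hα0 : 0 ≤ α) (hα : α < Real.sqrt (3 / 8)) :
    ∃ C : ℝ, 0 ≤ C ∧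
      ∀ (l₁ l₂ : ℕ), (l₁, l₂) ≠ (0, 0) →
      ∀ (η : ℝ), α < η →
      ∀ (f : ℝ × ℝ → ℝ),
        IntegrableOn (fun p => (Real.exp (η * (p.1 + p.2)) * f p) ^ 2) Om →
      ∀ (T : ℝ × ℝ → ℝ), MemH10 T →
        (∀ w : ℝ × ℝ → ℝ, MemH10 w → aform l₁ l₂ T w = ∫ p in Om, f p * w p) →
        expH1norm α T
          ≤ C * Real.sqrt (∫ p in Om, (Real.exp (η * (p.1 + p.2)) * f p) ^ 2) := by
  have hα2 : α ^ 2 < 3 / 8 := by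
    have := pow_lt_pow_left₀ hα hα0 two_ne_zero
    rwa [Real.sq_sqrt (by norm_num)] at this
  obtain ⟨K, hK0, hK⟩ := exists_integral_expTrunc_le hα0 hα2
  refine ⟨Real.sqrt K, Real.sqrt_nonneg _, ?_⟩
  intro l₁ l₂ hl η hη f hf T hT hweak
  rw [expH1norm, ← Real.sqrt_mul hK0]
  refine Real.sqrt_le_sqrt ?_
  have hε : ∀ n : ℕ, 0 < 1 / ((n : ℝ) + 1) := fun n => Nat.one_div_pos_of_nat
  have hε0 := tendsto_one_div_add_atTop_nhds_zero_nat (𝕜 := ℝ)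
  refine (integrable_and_integral_le_of_tendsto
    (g := fun (n : ℕ) p => expTrunc (1 / ((n : ℝ) + 1)) α T p ^ 2
      + fderiv ℝ (expTrunc (1 / ((n : ℝ) + 1)) α T) p (1, 0) ^ 2
      + fderiv ℝ (expTrunc (1 / ((n : ℝ) + 1)) α T) p (0, 1) ^ 2)
    (fun n => ?_) (fun n => Filter.Eventually.of_forall fun p => ?_)
    (fun n => hK l₁ l₂ hl η hη.le f hf T hT hweak _ (hε n))
    ((ae_restrict_mem isOpen_Om.measurableSet).mono fun p hp => ?_)).2
  · have hu := hT.memH10_expTrunc (hε n) hα0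
    exact (hu.integrable_sq.add hu.integrable_fst_sq).add hu.integrable_snd_sq
  · simp only [Pi.zero_apply]
    positivity
  · obtain ⟨-, e1, e2⟩ := fderiv_exp_mul (s := α) (γ := fun r => r)
      (hasDerivAt_id' p.1) (hasDerivAt_id' p.2) (hT.differentiableAt hp)
    rw [e1, e2]
    have hden : ∀ r : ℝ, Filter.Tendsto (fun n : ℕ => 1 + 1 / ((n : ℝ) + 1) * r) Filter.atTop
        (nhds 1) := fun r => by simpa using (hε0.mul_const r).const_add 1
    have htr : ∀ r : ℝ, Filter.Tendsto (fun n : ℕ => truncId (1 / ((n : ℝ) + 1)) r) Filter.atTop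
        (nhds r) := fun r => by
      simpa [truncId, Pi.div_def] using (tendsto_const_nhds (x := r)).div (hden r) one_ne_zero
    have hdt : ∀ r : ℝ, Filter.Tendsto (fun n : ℕ => 1 / (1 + 1 / ((n : ℝ) + 1) * r) ^ 2)
        Filter.atTop (nhds 1) := fun r => by
      simpa [Pi.div_def] using (tendsto_const_nhds (x := (1 : ℝ))).div ((hden r).pow 2) (by norm_num)
    have hexp : Filter.Tendsto (fun n : ℕ => Real.exp (α * (truncId (1 / ((n : ℝ) + 1)) p.1
        + truncId (1 / ((n : ℝ) + 1)) p.2))) Filter.atTop (nhds (Real.exp (α * (p.1 + p.2)))) :=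
      (Real.continuous_exp.tendsto _).comp (((htr p.1).add (htr p.2)).const_mul α)
    simp only [(hT.fderiv_expTrunc (hε _) α hp).2.1, (hT.fderiv_expTrunc (hε _) α hp).2.2]
    exact (((hexp.mul_const _).pow 2).add
      ((hexp.mul ((((hdt p.1).const_mul α).mul_const _).const_add _)).pow 2)).add
      ((hexp.mul ((((hdt p.2).const_mul α).mul_const _).const_add _)).pow 2)
end
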